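/- arXiv:1907.09908 — 2 statements merged into one kernel-verified Lean document; each statement's English description precedes it below -/
import Mathlib

section
/- φ̃(n) = 16 if and only if n = 144. -/
/-- φ̃(n): number of m with 1 ≤ m ≤ n, gcd(m,n)=1, m not prime. -/
def phiT (n : ℕ) : ℕ :=
  ((Finset.Icc 1 n).filter (fun m => Nat.gcd m n = 1 ∧ ¬ m.Prime)).card

/-- The product of the first k primes. -/
noncomputable def primorialN (k : ℕ) : ℕ := ∏ i ∈ Finset.range k, Nat.nth Nat.Prime i

/-- The number of non-primes `m ≤ c` coprime to `n`. -/
def nonprimeCoprimeCount (n c : ℕ) : ℕ :=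
  ((Finset.Icc 1 c).filter (fun m => Nat.gcd m n = 1 ∧ ¬ m.Prime)).card

/-- A primality test valid below `31 ^ 2`, using the product of the primes below `31`. -/
def smallPrimeTest (m : ℕ) : Bool :=
  !Nat.beq m 1 && (Nat.beq (Nat.gcd m 6469693230) 1 ||
    [2, 3, 5, 7, 11, 13, 17, 19, 23, 29].contains m)

/-- A recursive version of `nonprimeCoprimeCount`, valid below `31 ^ 2`. -/
def fastCount (n : ℕ) : ℕ → ℕ
  | 0 => 0
  | c + 1 => bif Nat.beq (Nat.gcd (c + 1) n) 1 && !smallPrimeTest (c + 1)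
      then fastCount n c + 1 else fastCount n c

theorem prime_dvd_primorial_thirty {p : ℕ} (hp : p.Prime) :
    p ∣ 6469693230 ↔ p ∈ [2, 3, 5, 7, 11, 13, 17, 19, 23, 29] := by
  constructor
  · intro h
    rw [show 6469693230 = 2 * 3 * 5 * 7 * 11 * 13 * 17 * 19 * 23 * 29 by norm_num] at h
    simp only [hp.dvd_mul] at h
    have key : ∀ q : ℕ, q.Prime → p ∣ q → p = q := fun q hq h =>
      (Nat.prime_dvd_prime_iff_eq hp hq).1 h
    simp only [List.mem_cons, List.not_mem_nil, or_false]
    rcases h with ((((((((h | h) | h) | h) | h) | h) | h) | h) | h) | h <;>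
      · have := key _ (by norm_num) h
        simp [this]
  · intro h
    simp only [List.mem_cons, List.not_mem_nil, or_false] at h
    rcases h with rfl | rfl | rfl | rfl | rfl | rfl | rfl | rfl | rfl | rfl <;> norm_num

theorem smallPrimeTest_iff {m : ℕ} (h0 : 0 < m) (hm : m < 961) :
    smallPrimeTest m = true ↔ m.Prime := by
  simp only [smallPrimeTest, Bool.and_eq_true, Bool.or_eq_true, Bool.not_eq_true',
    Nat.beq_eq, ← Bool.not_eq_true, List.contains_iff_mem]
  constructor
  · rintro ⟨h1, h | h⟩
    · by_contra hnp
      have hq := Nat.minFac_prime h1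
      have hsq := Nat.minFac_sq_le_self h0 hnp
      have hlt : m.minFac < 31 := by nlinarith
      have hmem : m.minFac ∣ 6469693230 := by
        rw [prime_dvd_primorial_thirty hq]
        generalize m.minFac = q at hq hlt
        interval_cases q <;> first | decide | (exfalso; revert hq; norm_num)
      exact hq.one_lt.ne' (Nat.dvd_one.1 (h ▸ Nat.dvd_gcd m.minFac_dvd hmem))
    · simp only [List.mem_cons, List.not_mem_nil, or_false] at h
      rcases h with rfl | rfl | rfl | rfl | rfl | rfl | rfl | rfl | rfl | rfl <;> norm_num
  · intro hp
    refine ⟨hp.one_lt.ne', ?_⟩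
    rw [← prime_dvd_primorial_thirty hp]
    exact Nat.coprime_or_dvd_of_prime hp _

theorem fastCount_eq (n : ℕ) {c : ℕ} (hc : c < 961) :
    fastCount n c = nonprimeCoprimeCount n c := by
  induction c with
  | zero => rfl
  | succ c ih =>
    have hcond : (Nat.beq (Nat.gcd (c + 1) n) 1 && !smallPrimeTest (c + 1)) =
        decide (Nat.gcd (c + 1) n = 1 ∧ ¬ (c + 1).Prime) := by
      rw [Bool.eq_iff_iff]
      simp only [Bool.and_eq_true, Nat.beq_eq, Bool.not_eq_true', ← Bool.not_eq_true,
        smallPrimeTest_iff c.succ_pos hc, decide_eq_true_eq]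
    rw [fastCount, ih (by lia), hcond]
    simp only [nonprimeCoprimeCount, Finset.card_filter]
    rw [Finset.sum_Icc_succ_top (by lia)]
    by_cases h : Nat.gcd (c + 1) n = 1 ∧ ¬ (c + 1).Prime <;> simp [h]

theorem nonprimeCoprimeCount_mono (n : ℕ) : Monotone (nonprimeCoprimeCount n) :=
  fun _ _ h => Finset.card_le_card
    (Finset.filter_subset_filter _ (Finset.Icc_subset_Icc_right h))

theorem fastCount_small : ∀ n < 144, fastCount n n ≠ 16 := by decide +kernel

theorem fastCount_medium : ∀ n < 961, 144 < n →
    Nat.blt 16 (fastCount n 144) || !Nat.beq (fastCount n n) 16 := by decide +kernel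

theorem phiT_eq_sixteen_of_lt {n : ℕ} (hn : n < 961) (h : phiT n = 16) : n = 144 := by
  have hf : fastCount n n = 16 := (fastCount_eq n hn).trans h
  rcases lt_trichotomy n 144 with hlt | heq | hgt
  · exact absurd hf (fastCount_small n hlt)
  · exact heq
  · have hm := fastCount_medium n hn hgt
    have hle : fastCount n 144 ≤ fastCount n n := by
      rw [fastCount_eq n hn, fastCount_eq n (by norm_num)]
      exact nonprimeCoprimeCount_mono n hgt.le
    simp only [hf, Nat.blt_eq, Nat.beq_refl, Bool.not_true, Bool.or_false] at hm
    lia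

theorem phiT_one_hundred_forty_four : phiT 144 = 16 :=
  (fastCount_eq 144 (by norm_num)).symm.trans (by decide +kernel)

theorem mul_primorial_pred_le {p s : ℕ} (hp : p.Prime) (h : p ≤ s) :
    p * primorial (p - 1) ≤ primorial s := by
  refine le_trans (le_of_eq ?_) (primorial_mono h)
  obtain ⟨q, rfl⟩ : ∃ q, p = q + 1 := ⟨p - 1, (Nat.succ_pred_prime hp).symm⟩
  rw [primorial, primorial, Finset.range_add_one (n := q + 1), Finset.filter_insert, if_pos hp,
    Finset.prod_insert (by simp), Nat.add_sub_cancel]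

theorem succ_pow_seven_le_primorial {s : ℕ} (hs : 31 ≤ s) : (s + 1) ^ 7 ≤ primorial s := by
  induction s using Nat.strong_induction_on with
  | _ s ih =>
    have hbase : ∀ a b : ℕ, a ≤ s → s < b → b ^ 7 ≤ primorial a → (s + 1) ^ 7 ≤ primorial s :=
      fun a b ha hb h => (Nat.pow_le_pow_left hb 7).trans (h.trans (primorial_mono ha))
    rcases lt_or_ge s 37 with h | h37
    · exact hbase 31 37 hs h (by decide +kernel)
    rcases lt_or_ge s 67 with h | h67
    · exact hbase 37 67 h37 h (by decide +kernel)
    rcases lt_or_ge s 256 with h | h256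
    · exact hbase 67 256 h67 h (by decide +kernel)
    obtain ⟨p, hp, hlo, hhi⟩ := Nat.exists_prime_lt_and_le_two_mul (s / 2) (by lia)
    have hps : p ≤ s := by lia
    have hind := ih (p - 1) (by lia) (by lia)
    rw [Nat.sub_add_cancel hp.one_le] at hind
    calc (s + 1) ^ 7 ≤ (2 * p) ^ 7 := Nat.pow_le_pow_left (by lia) 7
      _ = 128 * p ^ 7 := by ring
      _ ≤ p * primorial (p - 1) := Nat.mul_le_mul (by lia) hind
      _ ≤ primorial s := mul_primorial_pred_le hp hps

theorem six_le_card_primes_not_dvd {n : ℕ} (hn : 961 ≤ n) :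
    6 ≤ ((Finset.range (n.sqrt + 1)).filter (fun p => p.Prime ∧ ¬ p ∣ n)).card := by
  set s := n.sqrt
  have hs : 31 ≤ s := Nat.le_sqrt.2 hn
  by_contra! hcard
  have hsplit : primorial s =
      (∏ p ∈ (Finset.range (s + 1)).filter (fun p => p.Prime ∧ p ∣ n), p) *
        ∏ p ∈ (Finset.range (s + 1)).filter (fun p => p.Prime ∧ ¬ p ∣ n), p := by
    rw [primorial, ← Finset.prod_filter_mul_prod_filter_not _ (fun p => p ∣ n),
      Finset.filter_filter, Finset.filter_filter]
  have hdvd : (∏ p ∈ (Finset.range (s + 1)).filter (fun p => p.Prime ∧ p ∣ n), p) ≤ n :=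
    Nat.le_of_dvd (by lia) (Finset.prod_primes_dvd n
      (fun p hp => (Finset.mem_filter.1 hp).2.1.prime) (fun p hp => (Finset.mem_filter.1 hp).2.2))
  have hrest : (∏ p ∈ (Finset.range (s + 1)).filter (fun p => p.Prime ∧ ¬ p ∣ n), p) ≤ s ^ 5 :=
    (Finset.prod_le_pow_card _ _ s (fun p hp => by
      have := Finset.mem_range.1 (Finset.mem_filter.1 hp).1
      lia)).trans (Nat.pow_le_pow_right (by lia) (by lia))
  have hlt : n < (s + 1) ^ 2 := Nat.lt_succ_sqrt' n
  have hcontra : primorial s < (s + 1) ^ 7 :=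
    calc primorial s ≤ n * s ^ 5 := hsplit ▸ Nat.mul_le_mul hdvd hrest
      _ < (s + 1) ^ 2 * s ^ 5 := Nat.mul_lt_mul_of_pos_right hlt (by positivity)
      _ ≤ (s + 1) ^ 2 * (s + 1) ^ 5 := by gcongr; lia
      _ = (s + 1) ^ 7 := by ring
  exact absurd (succ_pow_seven_le_primorial hs) (not_le.2 hcontra)

theorem mul_injOn_sym2_primes {T : Finset ℕ} (hT : ∀ p ∈ T, p.Prime) :
    Set.InjOn (Sym2.mul (M := ℕ)) T.sym2 := by
  intro x hx y hy hxy
  induction x using Sym2.ind with | _ a b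
  induction y using Sym2.ind with | _ c d
  simp only [Finset.mem_coe, Finset.mk_mem_sym2_iff] at hx hy
  simp only [Sym2.mul_mk] at hxy
  have ha := hT a hx.1
  have hb := hT b hx.2
  have hc := hT c hy.1
  have hd := hT d hy.2
  rw [Sym2.eq_iff]
  rcases (ha.dvd_mul).1 (hxy ▸ dvd_mul_right a b) with h | h
  · obtain rfl := (Nat.prime_dvd_prime_iff_eq ha hc).1 h
    exact Or.inl ⟨rfl, Nat.eq_of_mul_eq_mul_left ha.pos hxy⟩
  · obtain rfl := (Nat.prime_dvd_prime_iff_eq ha hd).1 h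
    exact Or.inr ⟨rfl, Nat.eq_of_mul_eq_mul_left ha.pos (hxy.trans (mul_comm _ _))⟩

theorem choose_card_succ_two_le_phiT {n : ℕ} {T : Finset ℕ}
    (hT : ∀ p ∈ T, p.Prime ∧ ¬ p ∣ n ∧ p ≤ n.sqrt) : (T.card + 1).choose 2 ≤ phiT n := by
  rw [← Finset.card_sym2, phiT]
  refine Finset.card_le_card_of_injOn Sym2.mul ?_ (mul_injOn_sym2_primes fun p hp => (hT p hp).1)
  intro x hx
  induction x using Sym2.ind with | _ a b
  simp only [Finset.mem_coe, Finset.mk_mem_sym2_iff] at hx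
  obtain ⟨ha, han, has⟩ := hT a hx.1
  obtain ⟨hb, hbn, hbs⟩ := hT b hx.2
  simp only [Sym2.mul_mk, Finset.coe_filter, Finset.mem_Icc, Set.mem_ofPred_eq]
  exact ⟨⟨Nat.mul_pos ha.pos hb.pos, (Nat.mul_le_mul has hbs).trans (Nat.sqrt_le n)⟩,
    Nat.Coprime.mul_left ((ha.coprime_iff_not_dvd).2 han) ((hb.coprime_iff_not_dvd).2 hbn),
    Nat.not_prime_mul ha.ne_one hb.ne_one⟩

theorem sixteen_lt_phiT {n : ℕ} (hn : 961 ≤ n) : 16 < phiT n := by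
  have hle := choose_card_succ_two_le_phiT (n := n)
    (T := (Finset.range (n.sqrt + 1)).filter (fun p => p.Prime ∧ ¬ p ∣ n)) (fun p hp => by
      obtain ⟨hr, hp, hd⟩ := Finset.mem_filter.1 hp
      exact ⟨hp, hd, Nat.lt_succ_iff.1 (Finset.mem_range.1 hr)⟩)
  have hchoose := Nat.choose_le_choose 2 (Nat.succ_le_succ (six_le_card_primes_not_dvd hn))
  have : Nat.choose 7 2 = 21 := by decide
  lia

theorem stmt14 (n : ℕ) (hn : 0 < n) : phiT n = 16 ↔ n = 144 := by
  constructor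
  · intro h
    rcases lt_or_ge n 961 with hlt | hge
    · exact phiT_eq_sixteen_of_lt hlt h
    · exact absurd h (sixteen_lt_phiT hge).ne'
  · rintro rfl
    exact phiT_one_hundred_forty_four
end

section
/- φ̃ is strictly increasing on primorials from N_3 onward: for all i ≥ 3, φ̃(N_i) < φ̃(N_{i+1}). -/
/-- A number of the form `M - 2 * k` or `M - 4 * k` that is
not divisible by `p`, provided `p` does not divide `M` and `4 * k ≤ M`. -/
def coprimeReflection (M p k : ℕ) : ℕ :=
  if p ∣ M - 2 * k then M - 4 * k else M - 2 * k

theorem coprimeReflection_eq_or (M p k : ℕ) :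
    coprimeReflection M p k = M - 4 * k ∨ coprimeReflection M p k = M - 2 * k := by
  unfold coprimeReflection
  split_ifs <;> simp

theorem not_dvd_coprimeReflection {M p k : ℕ} (hpM : ¬ p ∣ M)
    (hk : 4 * k ≤ M) : ¬ p ∣ coprimeReflection M p k := by
  unfold coprimeReflection
  split_ifs with h
  · intro h'
    have h2k : p ∣ 2 * k := by
      have := Nat.dvd_sub h h'
      rwa [show M - 2 * k - (M - 4 * k) = 2 * k by omega] at this
    apply hpM
    have := Nat.dvd_add h h2k
    rwa [Nat.sub_add_cancel (by omega)] at this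
  · exact h

theorem coprime_sub_two_pow_mul {M k j : ℕ} (hM : Odd M) (hj : j ≠ 0) (hk : Nat.Coprime k M)
    (hle : 2 ^ j * k ≤ M) : Nat.Coprime (M - 2 ^ j * k) (2 * M) := by
  have hodd : Odd (M - 2 ^ j * k) :=
    Nat.Odd.sub_even hle hM ((even_two.pow_of_ne_zero hj).mul_right k)
  refine Nat.Coprime.mul_right (Nat.coprime_two_right.2 hodd) ?_
  rw [Nat.coprime_self_sub_left hle]
  exact ((Nat.coprime_two_left.2 hM).pow_left j).mul_left hk

theorem coprime_coprimeReflection {M p k : ℕ} (hM : Odd M) (hk : Nat.Coprime k M)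
    (hle : 4 * k ≤ M) : Nat.Coprime (coprimeReflection M p k) (2 * M) := by
  rcases coprimeReflection_eq_or M p k with h | h <;> rw [h]
  · exact coprime_sub_two_pow_mul (j := 2) hM two_ne_zero hk (by omega)
  · exact coprime_sub_two_pow_mul (j := 1) hM one_ne_zero hk (by omega)

theorem phiT_lt_phiT_mul_prime {M p q : ℕ} (hM : Odd M) (hp : p.Prime) (hq : q.Prime)
    (hpM : Nat.Coprime p (2 * M)) (hqM : Nat.Coprime q (2 * M)) (hpq : p < q)
    (hqp : q ≤ 2 * p) (hp11 : 11 ≤ p) (hpN : p ≤ 2 * M) :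
    phiT (2 * M) < phiT (2 * M * p) := by
  unfold phiT
  set S := (Finset.Icc 1 (2 * M)).filter (fun m => Nat.gcd m (2 * M) = 1 ∧ ¬ m.Prime) with hS
  have hpS : p ∉ S := by simp [hS, hp]
  rw [← Nat.succ_le_iff, Nat.succ_eq_add_one, ← Finset.card_insert_of_notMem hpS]
  have hmem : ∀ m ∈ insert p S, 1 ≤ m ∧ m ≤ 2 * M ∧ Nat.Coprime m (2 * M) := by
    intro m hm
    rcases Finset.mem_insert.1 hm with rfl | hm
    · exact ⟨by omega, hpN, hpM⟩
    · simp only [hS, Finset.mem_filter, Finset.mem_Icc] at hm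
      exact ⟨hm.1.1, hm.1.2, hm.2.1⟩
  have hbound : ∀ k, p * k ≤ 2 * M → 11 * k ≤ 2 * M := fun k hk =>
    (Nat.mul_le_mul_right k hp11).trans hk
  have hlarge : ∀ k, p * k ≤ 2 * M → 2 * M < q * coprimeReflection M p k := by
    intro k hk
    have h11 := hbound k hk
    have h12 : 12 * coprimeReflection M p k ≤ q * coprimeReflection M p k :=
      Nat.mul_le_mul_right _ (by omega)
    rcases coprimeReflection_eq_or M p k with h | h <;> omega
  refine Finset.card_le_card_of_injOn
    (fun m => if p ∣ m then q * coprimeReflection M p (m / p) else m) ?_ ?_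
  · intro m hm
    obtain ⟨h1, hle, hcop⟩ := hmem m hm
    simp only [Finset.coe_filter, Finset.mem_Icc, Set.mem_ofPred_eq]
    split_ifs with hd
    · obtain ⟨k, rfl⟩ := hd
      rw [Nat.mul_div_cancel_left k hp.pos]
      have h11 := hbound k hle
      have hl := hlarge k hle
      have hk : Nat.Coprime k M := (Nat.Coprime.coprime_mul_left hcop).coprime_mul_left_right
      have hs : 2 ≤ coprimeReflection M p k ∧ coprimeReflection M p k ≤ M := by
        rcases coprimeReflection_eq_or M p k with h | h <;> omega
      refine ⟨⟨by omega, ?_⟩, ?_, Nat.not_prime_mul hq.ne_one (by omega)⟩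
      · calc q * coprimeReflection M p k ≤ (2 * p) * M := Nat.mul_le_mul hqp hs.2
          _ = 2 * M * p := by ring
      · refine Nat.Coprime.mul_left (Nat.Coprime.mul_right hqM ?_) (Nat.Coprime.mul_right
          (coprime_coprimeReflection hM hk (by omega)) ?_)
        · exact (Nat.coprime_primes hq hp).2 hpq.ne'
        · refine ((Nat.Prime.coprime_iff_not_dvd hp).2 ?_).symm
          exact not_dvd_coprimeReflection
            ((Nat.Prime.coprime_iff_not_dvd hp).1 hpM.coprime_mul_left_right) (by omega)
    · have hmS : m ∈ S := by
        rcases Finset.mem_insert.1 hm with rfl | h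
        · exact absurd dvd_rfl hd
        · exact h
      exact ⟨⟨h1, hle.trans (Nat.le_mul_of_pos_right _ hp.pos)⟩,
        Nat.Coprime.mul_right hcop ((Nat.Prime.coprime_iff_not_dvd hp).2 hd).symm,
        (Finset.mem_filter.1 hmS).2.2⟩
  · intro m hm n hn hmn
    obtain ⟨-, hm, hmc⟩ := hmem m hm
    obtain ⟨-, hn, hnc⟩ := hmem n hn
    dsimp only at hmn
    split_ifs at hmn with hdm hdn hdn
    · obtain ⟨k, rfl⟩ := hdm
      obtain ⟨l, rfl⟩ := hdn
      rw [Nat.mul_div_cancel_left k hp.pos, Nat.mul_div_cancel_left l hp.pos] at hmn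
      have heq := Nat.eq_of_mul_eq_mul_left hq.pos hmn
      have hk := hbound k hm
      have hl := hbound l hn
      have hko : Odd k := Nat.coprime_two_right.1 hmc.coprime_mul_left.coprime_mul_right_right
      have hlo : Odd l := Nat.coprime_two_right.1 hnc.coprime_mul_left.coprime_mul_right_right
      rw [Nat.odd_iff] at hko hlo
      have : k = l := by
        rcases coprimeReflection_eq_or M p k with h | h <;>
        rcases coprimeReflection_eq_or M p l with h' | h' <;> omega
      rw [this]
    · obtain ⟨k, rfl⟩ := hdm
      rw [Nat.mul_div_cancel_left k hp.pos] at hmn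
      have := hlarge k hm
      omega
    · obtain ⟨l, rfl⟩ := hdn
      rw [Nat.mul_div_cancel_left l hp.pos] at hmn
      have := hlarge l hn
      omega
    · exact hmn

theorem primorialN_succ (i : ℕ) : primorialN (i + 1) = primorialN i * Nat.nth Nat.Prime i :=
  Finset.prod_range_succ _ _

theorem coprime_primorialN {r i : ℕ} (hr : r.Prime) (hi : Nat.nth Nat.Prime i ≤ r) :
    Nat.Coprime r (primorialN i) := by
  refine Nat.Coprime.prod_right fun j hj => ?_
  refine (Nat.coprime_primes hr (Nat.prime_nth_prime j)).2 (ne_of_gt ?_)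
  exact (Nat.nth_strictMono Nat.infinite_setOfPred_prime (Finset.mem_range.1 hj)).trans_le hi

theorem exists_odd_primorialN_succ (i : ℕ) : ∃ M, Odd M ∧ primorialN (i + 1) = 2 * M := by
  refine ⟨∏ j ∈ Finset.range i, Nat.nth Nat.Prime (j + 1), ?_, ?_⟩
  · refine Finset.prod_induction _ Odd (fun _ _ => Odd.mul) odd_one fun j _ => ?_
    refine (Nat.prime_nth_prime _).odd_of_ne_two (ne_of_gt ?_)
    rw [← Nat.nth_prime_zero_eq_two]
    exact Nat.nth_strictMono Nat.infinite_setOfPred_prime j.succ_pos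
  · rw [primorialN, Finset.prod_range_succ', Nat.nth_prime_zero_eq_two, mul_comm]

theorem nth_prime_le_primorialN {i : ℕ} (hi : 2 ≤ primorialN i - 1) :
    Nat.nth Nat.Prime i ≤ primorialN i := by
  obtain ⟨r, hr, hdvd⟩ := Nat.exists_prime_and_dvd (n := primorialN i - 1) (by omega)
  have hrle := Nat.le_of_dvd (by omega) hdvd
  by_contra! hlt
  have hri : Nat.count Nat.Prime r < i := by
    refine (Nat.nth_lt_nth Nat.infinite_setOfPred_prime).1 ?_
    rw [Nat.nth_count hr]
    exact lt_of_le_of_lt (by omega) hlt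
  have hrN : r ∣ primorialN i := by
    have := Finset.dvd_prod_of_mem (Nat.nth Nat.Prime) (Finset.mem_range.2 hri)
    rwa [Nat.nth_count hr] at this
  have := Nat.dvd_sub hrN hdvd
  rw [show primorialN i - (primorialN i - 1) = 1 by omega] at this
  exact hr.one_lt.ne' (Nat.dvd_one.1 this)

theorem primorialN_three : primorialN 3 = 30 := by
  simp [primorialN, Finset.prod_range_succ, Nat.nth_prime_zero_eq_two,
    Nat.nth_prime_one_eq_three, Nat.nth_prime_two_eq_five]

theorem primorialN_four : primorialN 4 = 210 := by
  rw [primorialN_succ, primorialN_three, Nat.nth_prime_three_eq_seven]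

theorem phiT_thirty_lt : phiT 30 < phiT 210 := by
  decide +kernel

theorem stmt18 (i : ℕ) (hi : 3 ≤ i) :
    phiT (primorialN i) < phiT (primorialN (i + 1)) := by
  rcases hi.eq_or_lt with rfl | hi
  · rw [primorialN_three, primorialN_four]
    exact phiT_thirty_lt
  · have hp := Nat.prime_nth_prime i
    have hp11 : 11 ≤ Nat.nth Nat.Prime i := by
      rw [← Nat.nth_prime_four_eq_eleven]
      exact Nat.nth_monotone Nat.infinite_setOfPred_prime hi
    obtain ⟨q, hq, hpq, hqp⟩ := Nat.exists_prime_lt_and_le_two_mul _ hp.ne_zero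
    have hpN : Nat.nth Nat.Prime i ≤ primorialN i := by
      apply nth_prime_le_primorialN
      have hdvd : primorialN 3 ∣ primorialN i :=
        Finset.prod_dvd_prod_of_subset _ _ _ (Finset.range_subset_range.2 hi.le)
      have hpos : 0 < primorialN i := Finset.prod_pos fun j _ => (Nat.prime_nth_prime j).pos
      have := Nat.le_of_dvd hpos hdvd
      rw [primorialN_three] at this
      omega
    have hpc := coprime_primorialN hp le_rfl
    have hqc := coprime_primorialN hq hpq.le
    obtain ⟨M, hM, hN⟩ := exists_odd_primorialN_succ (i - 1)
    rw [Nat.sub_add_cancel (by omega)] at hN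
    rw [primorialN_succ]
    rw [hN] at hpN hpc hqc ⊢
    exact phiT_lt_phiT_mul_prime hM hp hq hpc hqc hpq hqp hp11 hpN
end
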